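/- For any simplicial set X, the collection Q_X with colour set X_1, defined by Q_X(c_1, …, c_n | c_0) = { x ∈ X_n : the edge of x from vertex i−1 to vertex i equals c_i for 1 ≤ i ≤ n, and the edge from vertex 0 to vertex n equals c_0 }, together with the cocomposition maps induced by the operad of standard simplices, is an invertible cooperad if and only if X is a 2-Segal set. -/

import Mathlib

/-- A triangulation of a regular `(n+1)`-gon with vertices labelled cyclically
by `0, …, n`: a maximal collection of pairwise non-crossing diagonals. -/
structure Triangulation (n : ℕ) where
  diag : Finset (Fin (n + 1) × Fin (n + 1))
  mem_diag : ∀ p ∈ diag, p.1.val + 1 < p.2.val ∧ ¬(p.1.val = 0 ∧ p.2.val = n)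
  noncross : ∀ p ∈ diag, ∀ q ∈ diag,
    ¬(p.1.val < q.1.val ∧ q.1.val < p.2.val ∧ p.2.val < q.2.val)
  card_eq : diag.card = n - 2

namespace Triangulation

/-- The 1-simplices of `Δ[𝒯]`: sides of the polygon and diagonals of `𝒯`. -/
def IsEdge {n : ℕ} (𝒯 : Triangulation n) (a b : Fin (n + 1)) : Prop :=
  a < b ∧ (b.val = a.val + 1 ∨ (a.val = 0 ∧ b.val = n) ∨ (a, b) ∈ 𝒯.diag)

/-- The 2-simplices (triangles) of `Δ[𝒯]`. -/
def IsTri {n : ℕ} (𝒯 : Triangulation n) (a b c : Fin (n + 1)) : Prop :=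
  𝒯.IsEdge a b ∧ 𝒯.IsEdge b c ∧ 𝒯.IsEdge a c

end Triangulation

/-- Partial sums of arities: `psum k j = k 0 + ⋯ + k (j-1)`. -/
def psum {n : ℕ} (k : Fin n → ℕ) (j : ℕ) : ℕ :=
  ∑ t ∈ Finset.univ.filter (fun t : Fin n => t.val < j), k t

theorem psum_le {n : ℕ} (k : Fin n → ℕ) (j : ℕ) : psum k j ≤ ∑ t, k t :=
  Finset.sum_le_sum_of_subset (Finset.filter_subset _ _)

theorem psum_mono {n : ℕ} (k : Fin n → ℕ) : Monotone (psum k) := by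
  intro i j hij
  refine Finset.sum_le_sum_of_subset ?_
  intro t ht
  simp only [Finset.mem_filter, Finset.mem_univ, true_and] at ht ⊢
  omega

theorem psum_succ {n : ℕ} (k : Fin n → ℕ) (i : Fin n) :
    psum k (i.val + 1) = psum k i.val + k i := by
  unfold psum
  rw [show Finset.univ.filter (fun t : Fin n => t.val < i.val + 1) =
      insert i (Finset.univ.filter (fun t : Fin n => t.val < i.val)) from ?_,
    Finset.sum_insert (by simp)]
  · ring
  · ext t
    simp only [Finset.mem_insert, Finset.mem_filter, Finset.mem_univ, true_and]
    constructor
    · intro h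
      rcases Nat.lt_succ_iff_lt_or_eq.mp h with h | h
      · exact Or.inr h
      · exact Or.inl (Fin.ext h)
    · rintro (rfl | h) <;> omega

theorem psum_add_le {n : ℕ} (k : Fin n → ℕ) (i : Fin n) (r : ℕ) (hr : r ≤ k i) :
    psum k i.val + r ≤ ∑ t, k t := by
  have h1 := psum_succ k i
  have h2 := psum_le k (i.val + 1)
  omega

open CategoryTheory Simplicial

/-- The set of `n`-simplices of a simplicial set. -/
abbrev XS (X : SSet) (n : ℕ) : Type := X.obj (Opposite.op (SimplexCategory.mk n))

/-- The edge of an `n`-simplex of a simplicial set `X` from vertex `a` to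
vertex `b`. -/
def sEdge (X : SSet) {n : ℕ} (a b : Fin (n + 1)) (h : a ≤ b) (x : XS X n) :
    XS X 1 :=
  X.map (SimplexCategory.mkOfLe a b h).op x

/-- The triangle of an `n`-simplex of a simplicial set `X` with vertices
`a ≤ b ≤ c`. -/
def sTri (X : SSet) {n : ℕ} (a b c : Fin (n + 1)) (h1 : a ≤ b) (h2 : b ≤ c)
    (x : XS X n) : XS X 2 :=
  X.map (SimplexCategory.mkOfLeComp a b c h1 h2).op x

/-- The set of `n`-ary operations of the `X₁`-coloured cooperad `Q_X` of a
simplicial set `X`: the `n`-simplices whose consecutive edges are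
`c 0, …, c (n-1)` and whose long edge is `c₀`. -/
def QX (X : SSet) (n : ℕ) (c : Fin n → XS X 1) (c0 : XS X 1) : Type :=
  {x : XS X n //
    (∀ i : Fin n, sEdge X i.castSucc i.succ (Fin.castSucc_le_succ i) x = c i) ∧
    sEdge X 0 (Fin.last n) (Fin.zero_le _) x = c0}

/-- The outer cocomposition operator `[n] ⟶ [k 0 + ⋯ + k (n-1)]`, sending
vertex `j` to `k 0 + ⋯ + k (j-1)`; it is induced by the operad structure on
the standard simplices. -/
def outerHom {n : ℕ} (k : Fin n → ℕ) :
    (SimplexCategory.mk n) ⟶ SimplexCategory.mk (∑ t, k t) :=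
  SimplexCategory.mkHom
    ⟨fun j => ⟨psum k j.val, Nat.lt_succ_of_le (psum_le k j.val)⟩,
      fun a b hab => by
        simp only [Fin.mk_le_mk]
        exact psum_mono k (Fin.le_def.mp hab)⟩

/-- The `i`-th inner cocomposition operator `[k i] ⟶ [k 0 + ⋯ + k (n-1)]`,
sending vertex `j` to `k 0 + ⋯ + k (i-1) + j`. -/
def innerHom {n : ℕ} (k : Fin n → ℕ) (i : Fin n) :
    (SimplexCategory.mk (k i)) ⟶ SimplexCategory.mk (∑ t, k t) :=
  SimplexCategory.mkHom
    ⟨fun j => ⟨psum k i.val + j.val,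
        Nat.lt_succ_of_le (psum_add_le k i j.val (Nat.lt_succ_iff.mp j.isLt))⟩,
      fun a b hab => by
        simp only [Fin.mk_le_mk]
        have := Fin.le_def.mp hab
        omega⟩


/-- Total operator `[m] ⟶ [M]` from a function on naturals. -/
def hm (m M : ℕ) (f : ℕ → ℕ) : SimplexCategory.mk m ⟶ SimplexCategory.mk M :=
  SimplexCategory.mkHom
    ⟨fun j => ⟨min ((Finset.range (j.val + 1)).sup f) M, by omega⟩,
      fun a b hab => by
        simp only [Fin.mk_le_mk]
        have := Fin.le_def.mp hab
        exact min_le_min (Finset.sup_mono (Finset.range_mono (by omega))) le_rfl⟩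

/-- `f` is monotone on `[0,m]` with values in `[0,M]`. -/
def Good (m M : ℕ) (f : ℕ → ℕ) : Prop :=
  ∀ i j, i ≤ j → j ≤ m → f i ≤ f j ∧ f j ≤ M

theorem hm_val {m M : ℕ} {f : ℕ → ℕ} (h : Good m M f) (j : Fin (m + 1)) :
    ((hm m M f).toOrderHom j).val = f j.val := by
  change min ((Finset.range (j.val + 1)).sup f) M = f j.val
  have h1 : (Finset.range (j.val + 1)).sup f = f j.val := by
    apply le_antisymm
    · apply Finset.sup_le
      intro i hi
      have := Finset.mem_range.mp hi
      exact (h i j.val (by omega) (by omega)).1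
    · exact Finset.le_sup (f := f) (Finset.mem_range.mpr (by omega))
  rw [h1]
  exact min_eq_left (h j.val j.val le_rfl (by omega)).2

theorem hom_ext_val {m M : ℕ} {φ ψ : SimplexCategory.mk m ⟶ SimplexCategory.mk M}
    (h : ∀ j : Fin (m + 1), (φ.toOrderHom j).val = (ψ.toOrderHom j).val) : φ = ψ := by
  apply SimplexCategory.Hom.ext
  apply OrderHom.ext
  funext j
  exact Fin.ext (h j)

/-- Restriction of a simplex along a total operator. -/
def R (X : SSet) (m M : ℕ) (f : ℕ → ℕ) (x : XS X M) : XS X m := X.map (hm m M f).op x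

theorem map_eq_R (X : SSet) {m M : ℕ} (φ : SimplexCategory.mk m ⟶ SimplexCategory.mk M)
    (f : ℕ → ℕ) (h : ∀ j : Fin (m + 1), (φ.toOrderHom j).val = f j.val) (x : XS X M) :
    X.map φ.op x = R X m M f x := by
  have : φ = hm m M f := by
    apply hom_ext_val
    intro j
    rw [hm_val, h]
    intro i j hij hj
    have e1 := h ⟨i, by omega⟩
    have e2 := h ⟨j, by omega⟩
    have hj' : j < m + 1 := by omega
    have hi' : i < m + 1 := by omega
    have := φ.toOrderHom.monotone (show (⟨i, hi'⟩ : Fin (m+1)) ≤ ⟨j, hj'⟩ from hij)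
    have h3 := Fin.le_def.mp this
    have h4 := (φ.toOrderHom ⟨j, hj'⟩).isLt
    simp only [SimplexCategory.len_mk] at h4
    constructor
    · exact (e1.symm.le.trans h3).trans e2.le
    · have : f j < M + 1 := e2.symm.le.trans_lt h4
      omega
  rw [this, R]

theorem R_congr (X : SSet) {m M : ℕ} {f g : ℕ → ℕ} (x : XS X M)
    (h : ∀ j ≤ m, f j = g j) : R X m M f x = R X m M g x := by
  have : hm m M f = hm m M g := by
    apply hom_ext_val
    intro j
    change min ((Finset.range (j.val + 1)).sup f) M = min ((Finset.range (j.val + 1)).sup g) M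
    rw [Finset.sup_congr rfl]
    intro i hi
    have := Finset.mem_range.mp hi
    exact h i (by omega)
  rw [R, this, R]

theorem R_id (X : SSet) {m : ℕ} {f : ℕ → ℕ} (x : XS X m)
    (h : ∀ j ≤ m, f j = j) : R X m m f x = x := by
  rw [← map_eq_R X (𝟙 (SimplexCategory.mk m))]
  · simp
  · intro j
    rw [h j.val (by omega)]
    rfl

theorem R_R (X : SSet) {m k M : ℕ} {f g : ℕ → ℕ} (hf : Good k M f) (hg : Good m k g)
    (x : XS X M) : R X m k g (R X k M f x) = R X m M (fun j => f (g j)) x := by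
  rw [← map_eq_R X (hm m k g ≫ hm k M f)]
  · simp [R]
  · intro j
    have h1 := hm_val hf ((hm m k g).toOrderHom j)
    rw [hm_val hg] at h1
    exact h1

/-- Composite of restrictions, with prescribed result. -/
theorem R_R' (X : SSet) {m k M : ℕ} {f g : ℕ → ℕ} (r : ℕ → ℕ) (hf : Good k M f)
    (hg : Good m k g) (hr : ∀ j ≤ m, f (g j) = r j)
    (x : XS X M) : R X m k g (R X k M f x) = R X m M r x := by
  rw [R_R X hf hg]
  exact R_congr X x hr

/-- Edge operator. -/
def ed (a b : ℕ) : ℕ → ℕ := fun j => if j = 0 then a else b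

/-- Triangle operator. -/
def tr (a b c : ℕ) : ℕ → ℕ := fun j => if j = 0 then a else if j = 1 then b else c

theorem sEdge_eq (X : SSet) {n : ℕ} (a b : Fin (n + 1)) (h : a ≤ b) (x : XS X n) :
    sEdge X a b h x = R X 1 n (ed a.val b.val) x := by
  apply map_eq_R
  intro j
  fin_cases j <;> rfl

theorem sTri_eq (X : SSet) {n : ℕ} (a b c : Fin (n + 1)) (h : a ≤ b) (h' : b ≤ c) (x : XS X n) :
    sTri X a b c h h' x = R X 2 n (tr a.val b.val c.val) x := by
  apply map_eq_R
  intro j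
  fin_cases j <;> rfl

theorem outer_eq (X : SSet) {n : ℕ} (k : Fin n → ℕ) (x : XS X (∑ t, k t)) :
    X.map (outerHom k).op x = R X n (∑ t, k t) (psum k) x := by
  apply map_eq_R
  intro j
  rfl

theorem inner_eq (X : SSet) {n : ℕ} (k : Fin n → ℕ) (i : Fin n) (x : XS X (∑ t, k t)) :
    X.map (innerHom k i).op x = R X (k i) (∑ t, k t) (fun j => psum k i.val + j) x := by
  apply map_eq_R
  intro j
  rfl

theorem good_ed {a b n : ℕ} (h : a ≤ b) (h' : b ≤ n) : Good 1 n (ed a b) := by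
  intro i j hij hj
  simp only [ed]
  split_ifs <;> omega

theorem good_tr {a b c n : ℕ} (h : a ≤ b) (h' : b ≤ c) (h'' : c ≤ n) : Good 2 n (tr a b c) := by
  intro i j hij hj
  simp only [tr]
  split_ifs <;> omega

theorem R_ed (X : SSet) {k M : ℕ} {f : ℕ → ℕ} (hf : Good k M f) {a b : ℕ} (h : a ≤ b)
    (hb : b ≤ k) (x : XS X M) : R X 1 k (ed a b) (R X k M f x) = R X 1 M (ed (f a) (f b)) x := by
  apply R_R' X _ hf (good_ed h hb)
  intro j _
  simp only [ed]
  split_ifs <;> rfl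

theorem R_tr (X : SSet) {k M : ℕ} {f : ℕ → ℕ} (hf : Good k M f) {a b c : ℕ} (h : a ≤ b)
    (h' : b ≤ c) (hb : c ≤ k) (x : XS X M) :
    R X 2 k (tr a b c) (R X k M f x) = R X 2 M (tr (f a) (f b) (f c)) x := by
  apply R_R' X _ hf (good_tr h h' hb)
  intro j _
  simp only [tr]
  split_ifs <;> rfl

/-- The operator skipping the interior of an inserted `l`-simplex. -/
def dl (a l : ℕ) : ℕ → ℕ := fun j => if j ≤ a then j else j + l - 1

theorem good_dl {m a l M : ℕ} (h : M + 1 = m + l) (ha : a < m) : Good m M (dl a l) := by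
  intro i j hij hj
  simp only [dl]
  split_ifs <;> omega

theorem good_add {a l M : ℕ} (h : a + l ≤ M) : Good l M (fun j => a + j) := by
  intro i j hij hj
  constructor <;> dsimp only <;> omega

/-- Uniqueness of gluing. -/
def GU (X : SSet) (m a l M : ℕ) : Prop := ∀ v v' : XS X M,
  R X m M (dl a l) v = R X m M (dl a l) v' →
  R X l M (fun j => a + j) v = R X l M (fun j => a + j) v' → v = v'

def GE (X : SSet) (m a l M : ℕ) : Prop := ∀ (w : XS X m) (z : XS X l),
  R X 1 l (ed 0 l) z = R X 1 m (ed a (a + 1)) w →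
  ∃ v : XS X M, R X m M (dl a l) v = w ∧ R X l M (fun j => a + j) v = z

/-- All ear gluings. -/
def G2 (X : SSet) : Prop := ∀ m a, a < m → GU X m a 2 (m + 1) ∧ GE X m a 2 (m + 1)

theorem GU0 (X : SSet) {m a M : ℕ} (h : M + 1 = m + 0) (ha : a < m) : GU X m a 0 M := by
  intro v v' h1 _
  have := congrArg (R X M m (fun j => if j ≤ a then j else j + 1)) h1
  have hg : Good M m (fun j => if j ≤ a then j else j + 1) := by
    intro i j hij hj
    dsimp only
    split_ifs <;> omega
  rw [R_R X (good_dl h ha) hg, R_R X (good_dl h ha) hg, R_id, R_id] at this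
  · exact this
  all_goals
    intro j hj
    simp only [dl]
    split_ifs <;> omega

theorem GE0 (X : SSet) (H : G2 X) {m a M : ℕ} (h : M + 1 = m + 0) (ha : a < m) :
    GE X m a 0 M := by
  intro w z hz
  -- the edge is constant
  have hz0 : z = R X 0 m (fun _ => a) w := by
    have := congrArg (R X 0 1 (fun _ => 0)) hz
    rw [R_R X (good_ed (by omega) (by omega)) (by intro i j _ _; simp),
      R_R X (good_ed (by omega) (by omega)) (by intro i j _ _; simp), R_id] at this
    · rw [this]; rfl
    · intro j hj; simp [ed]; omega
  have gs : ∀ b, b ≤ m → Good (m + 1) m (fun j => if j ≤ b then j else j - 1) := by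
    intro b hb i j hij hj
    dsimp only
    split_ifs <;> omega
  have key : R X (m + 1) m (fun j => if j ≤ a then j else j - 1) w =
      R X (m + 1) m (fun j => if j ≤ a + 1 then j else j - 1) w := by
    apply (H m a ha).1
    · rw [R_R X (gs a (by omega)) (good_dl (by omega) ha),
        R_R X (gs (a+1) (by omega)) (good_dl (by omega) ha)]
      apply R_congr
      intro j hj
      simp only [dl]
      split_ifs <;> omega
    · rw [R_R X (gs a (by omega)) (good_add (by omega)),
        R_R X (gs (a+1) (by omega)) (good_add (by omega))]
      have e1 : ∀ u : ℕ → ℕ, Good 2 1 u → R X 2 1 u (R X 1 m (ed a (a+1)) w)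
          = R X 2 0 (fun _ => 0) z := by
        intro u hu
        rw [← hz, R_R' X (fun _ => 0) (good_ed (by omega) (by omega)) hu]
        intro j hj
        simp [ed]
      have e2 := e1 (fun j => if j ≤ 1 then 0 else 1) (by
        intro i j _ _; dsimp only; split_ifs <;> omega)
      have e3 := e1 (fun j => if j ≤ 0 then 0 else 1) (by
        intro i j _ _; dsimp only; split_ifs <;> omega)
      have := e2.trans e3.symm
      rw [R_R X (good_ed (by omega) (by omega)) (by
          intro i j _ _; dsimp only; split_ifs <;> omega),
        R_R X (good_ed (by omega) (by omega)) (by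
          intro i j _ _; dsimp only; split_ifs <;> omega)] at this
      refine (R_congr X w ?_).trans (this.trans (R_congr X w ?_))
      all_goals
        intro j hj
        have : j = 0 ∨ j = 1 ∨ j = 2 := by omega
        rcases this with rfl | rfl | rfl <;> simp [ed]
  have g3 : Good m (m + 1) (fun j => if j ≤ a + 1 then j else j + 1) := by
    intro i j hij hj
    dsimp only
    split_ifs <;> omega
  have key2 := congrArg (R X m (m + 1) (fun j => if j ≤ a + 1 then j else j + 1)) key
  rw [R_R X (gs a (by omega)) g3, R_R X (gs (a+1) (by omega)) g3] at key2
  rw [R_id X (f := fun j => if (if j ≤ a + 1 then j else j + 1) ≤ a + 1 then _ else _)] at key2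
  swap
  · intro j hj
    split_ifs <;> omega
  have gv : Good M m (fun j => if j ≤ a then j else j + 1) := by
    intro i j hij hj
    dsimp only
    split_ifs <;> omega
  refine ⟨R X M m (fun j => if j ≤ a then j else j + 1) w, ?_, ?_⟩
  · rw [R_R X gv (good_dl h ha)]
    refine (R_congr X w ?_).trans key2
    intro j hj
    simp only [dl]
    split_ifs <;> omega
  · rw [R_R X gv (good_add (by omega)), hz0]
    apply R_congr
    intro j hj
    split_ifs <;> omega

theorem GU1 (X : SSet) {m a M : ℕ} (h : M + 1 = m + 1) : GU X m a 1 M := by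
  obtain rfl : M = m := by omega
  intro v v' h1 _
  rw [R_id, R_id] at h1
  · exact h1
  all_goals
    intro j hj
    simp only [dl]
    split_ifs <;> omega

theorem GE1 (X : SSet) {m a M : ℕ} (h : M + 1 = m + 1) : GE X m a 1 M := by
  obtain rfl : M = m := by omega
  intro w z hz
  refine ⟨w, ?_, ?_⟩
  · apply R_id
    intro j hj
    simp only [dl]
    split_ifs <;> omega
  · rw [R_id X z] at hz
    · rw [hz]
      apply R_congr
      intro j hj
      simp only [ed]
      split_ifs <;> omega
    · intro j hj
      simp only [ed]
      split_ifs <;> omega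

theorem glue_all (X : SSet) (H : G2 X) (l : ℕ) : ∀ m a M, M + 1 = m + l → a < m →
    GU X m a l M ∧ GE X m a l M := by
  induction l using Nat.strong_induction_on with
  | _ l ih =>
  intro m a M hM ha
  match l, ih, hM with
  | 0, _, hM => exact ⟨GU0 X hM ha, GE0 X H hM ha⟩
  | 1, _, hM => exact ⟨GU1 X hM, GE1 X hM⟩
  | 2, _, hM =>
    obtain rfl : M = m + 1 := by omega
    exact H m a ha
  | l + 3, ih, hM =>
    obtain rfl : M = m + l + 2 := by omega
    have I := ih (l + 2) (by omega) m a (m + l + 1) (by omega) ha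
    have J := H (m + l + 1) (a + l + 1) (by omega)
    have K := H (l + 2) (l + 1) (by omega)
    have gA : Good (m + l + 1) (m + l + 2) (dl (a + l + 1) 2) := good_dl (by omega) (by omega)
    have gB : Good m (m + l + 1) (dl a (l + 2)) := good_dl (by omega) (by omega)
    have gC : Good m (m + l + 2) (dl a (l + 3)) := good_dl (by omega) (by omega)
    have gD : Good (l + 2) (l + 3) (dl (l + 1) 2) := good_dl (by omega) (by omega)
    have gE : Good (l + 2) (m + l + 1) (fun j => a + j) := good_add (by omega)
    have gF : Good (l + 3) (m + l + 2) (fun j => a + j) := good_add (by omega)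
    have gG : Good 2 (m + l + 2) (fun j => (a + l + 1) + j) := good_add (by omega)
    have gI : Good 2 (l + 3) (fun j => (l + 1) + j) := good_add (by omega)
    -- the relevant compositions
    have c1 : ∀ v, R X m (m + l + 1) (dl a (l + 2)) (R X (m + l + 1) (m + l + 2) (dl (a + l + 1) 2) v)
        = R X m (m + l + 2) (dl a (l + 3)) v := by
      intro v
      apply R_R' X _ gA gB
      intro j hj
      simp only [dl]
      split_ifs <;> omega
    have c2 : ∀ v, R X (l + 2) (m + l + 1) (fun j => a + j)
        (R X (m + l + 1) (m + l + 2) (dl (a + l + 1) 2) v)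
        = R X (l + 2) (l + 3) (dl (l + 1) 2) (R X (l + 3) (m + l + 2) (fun j => a + j) v) := by
      intro v
      rw [R_R X gA gE, R_R X gF gD]
      apply R_congr
      intro j hj
      simp only [dl]
      split_ifs <;> omega
    have c3 : ∀ v, R X 2 (l + 3) (fun j => (l + 1) + j) (R X (l + 3) (m + l + 2) (fun j => a + j) v)
        = R X 2 (m + l + 2) (fun j => (a + l + 1) + j) v := by
      intro v
      apply R_R' X _ gF gI
      intro j hj
      omega
    constructor
    · intro v v' h1 h2
      apply J.1
      · apply I.1
        · rw [c1, c1, h1]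
        · rw [c2, c2, h2]
      · rw [← c3, ← c3, h2]
    · intro w z hz
      obtain ⟨v', h1, h2⟩ := I.2 w (R X (l + 2) (l + 3) (dl (l + 1) 2) z) (by
        rw [R_ed X gD (by omega) (by omega), ← hz]
        apply R_congr
        intro j hj
        simp only [ed, dl]
        split_ifs <;> omega)
      obtain ⟨v, h3, h4⟩ := J.2 v' (R X 2 (l + 3) (fun j => (l + 1) + j) z) (by
        have := congrArg (R X 1 (l + 2) (ed (l + 1) (l + 2))) h2
        rw [R_ed X gE (by omega) (by omega), R_ed X gD (by omega) (by omega)] at this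
        refine Eq.trans ?_ this.symm
        rw [R_ed X gI (by omega) (by omega)]
        apply R_congr
        intro j hj
        simp only [ed, dl]
        split_ifs <;> omega)
      refine ⟨v, ?_, ?_⟩
      · rw [← c1, h3, h1]
      · apply K.1
        · rw [← c2, h3, h2]
        · rw [c3, h4]

theorem psum_zero {n : ℕ} (k : Fin n → ℕ) : psum k 0 = 0 := by
  simp [psum]

theorem psum_last {n : ℕ} (k : Fin n → ℕ) : psum k n = ∑ t, k t := by
  unfold psum
  congr 1
  ext t
  simp

theorem psum_decomp {n : ℕ} (k : Fin n → ℕ) : ∀ i ≤ n, ∀ t < psum k i,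
    ∃ (j : Fin n) (r : Fin (k j)), t = psum k j.val + r.val := by
  intro i
  induction i with
  | zero => intro _ t ht; rw [psum_zero] at ht; omega
  | succ i ih =>
    intro hi t ht
    by_cases h : t < psum k i
    · exact ih (by omega) t h
    · have h1 := psum_succ k ⟨i, by omega⟩
      dsimp only at h1
      exact ⟨⟨i, by omega⟩, ⟨t - psum k i, by omega⟩, by dsimp only; omega⟩

theorem good_psum {n : ℕ} (k : Fin n → ℕ) : Good n (∑ t, k t) (psum k) :=
  fun _ j hij _ => ⟨psum_mono k hij, psum_le k j⟩

theorem good_inner {n : ℕ} (k : Fin n → ℕ) (i : Fin n) :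
    Good (k i) (∑ t, k t) (fun j => psum k i.val + j) :=
  good_add (psum_add_le k i (k i) le_rfl)

theorem good_id {m M : ℕ} (h : m ≤ M) : Good m M (fun j => j) := by
  intro i j hij hj
  dsimp only
  omega

/-- Colour-free injectivity of cocomposition. -/
def LInj (X : SSet) (n : ℕ) (k : Fin n → ℕ) : Prop := ∀ x x' : XS X (∑ t, k t),
  R X n _ (psum k) x = R X n _ (psum k) x' →
  (∀ i : Fin n, R X (k i) _ (fun j => psum k i.val + j) x =
    R X (k i) _ (fun j => psum k i.val + j) x') → x = x'

def LSurj (X : SSet) (n : ℕ) (k : Fin n → ℕ) : Prop := ∀ (y : XS X n) (z : ∀ i, XS X (k i)),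
  (∀ i : Fin n, R X 1 (k i) (ed 0 (k i)) (z i) = R X 1 n (ed i.val (i.val + 1)) y) →
  ∃ x : XS X (∑ t, k t), R X n _ (psum k) x = y ∧
    ∀ i : Fin n, R X (k i) _ (fun j => psum k i.val + j) x = z i

/-- Outer operator after `i` gluings. -/
def oo {n : ℕ} (k : Fin n → ℕ) (i : ℕ) : ℕ → ℕ :=
  fun j => if j ≤ i then psum k j else psum k i + (j - i)

/-- Restriction to the stage after `i` gluings. -/
def rho {n : ℕ} (k : Fin n → ℕ) (i : ℕ) : ℕ → ℕ :=
  fun j => if j ≤ psum k i then j else psum k (i + (j - psum k i))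

theorem oo_le {n : ℕ} (k : Fin n → ℕ) {i j : ℕ} (h : j ≤ i) : oo k i j = psum k j := if_pos h

theorem oo_gt {n : ℕ} (k : Fin n → ℕ) {i j : ℕ} (h : i < j) :
    oo k i j = psum k i + (j - i) := if_neg (by omega)

theorem dl_le {a l j : ℕ} (h : j ≤ a) : dl a l j = j := if_pos h

theorem dl_gt {a l j : ℕ} (h : a < j) : dl a l j = j + l - 1 := if_neg (by omega)

theorem good_oo {n : ℕ} (k : Fin n → ℕ) {i : ℕ} (hi : i ≤ n) :
    Good n (psum k i + (n - i)) (oo k i) := by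
  intro p q hpq hq
  have h1 := psum_mono k hpq
  simp only [oo]
  by_cases h2 : q ≤ i
  · have := psum_mono k h2
    rw [if_pos h2, if_pos (by omega)]
    omega
  · rw [if_neg h2]
    split_ifs with h3
    · have := psum_mono k h3
      omega
    · omega

theorem good_rho {n : ℕ} (k : Fin n → ℕ) (i m : ℕ) :
    Good m (∑ t, k t) (rho k i) := by
  intro p q hpq hq
  have h1 := psum_le k i
  have h2 := psum_le k (i + (q - psum k i))
  have h3 := psum_mono k (show i ≤ i + (q - psum k i) by omega)
  have h4 := psum_mono k (show i + (p - psum k i) ≤ i + (q - psum k i) by omega)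
  simp only [rho]
  split_ifs <;> omega

theorem lsurj_of_glue (X : SSet) (H : G2 X) (n : ℕ) (k : Fin n → ℕ) : LSurj X n k := by
  intro y z hyz
  have main : ∀ i ≤ n, ∃ w : XS X (psum k i + (n - i)), R X n _ (oo k i) w = y ∧
      ∀ t : Fin n, t.val < i → R X (k t) _ (fun j => psum k t.val + j) w = z t := by
    intro i
    induction i with
    | zero =>
      intro _
      refine ⟨R X _ n (fun j => j) y, ?_, by intro t ht; omega⟩
      have h0 := psum_zero k
      rw [R_R X (good_id (by omega)) (good_oo k (by omega)), R_id]
      intro j hj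
      simp only [oo]
      split_ifs with h
      · obtain rfl : j = 0 := by omega
        exact h0
      · omega
    | succ i ih =>
      intro hi
      obtain ⟨w, hw1, hw2⟩ := ih (by omega)
      have hs := psum_succ k ⟨i, by omega⟩
      dsimp only at hs
      have hg := (glue_all X H (k ⟨i, by omega⟩) (psum k i + (n - i)) (psum k i)
        (psum k (i + 1) + (n - (i + 1))) (by omega) (by omega)).2
      obtain ⟨v, hv1, hv2⟩ := hg w (z ⟨i, by omega⟩) (by
        rw [hyz, ← hw1, R_ed X (good_oo k (by omega)) (by omega) (by dsimp only; omega)]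
        apply R_congr
        intro j hj
        simp only [ed, oo]
        split_ifs <;> omega)
      refine ⟨v, ?_, ?_⟩
      · rw [← hw1, ← hv1, R_R X (good_dl (by omega) (by omega)) (good_oo k (by omega))]
        apply R_congr
        intro j hj
        by_cases h1 : j ≤ i
        · have := psum_mono k h1
          rw [oo_le k h1, oo_le k (by omega), dl_le this]
        · rw [oo_gt (i := i) k (by omega), dl_gt (by omega)]
          by_cases h2 : j ≤ i + 1
          · obtain rfl : j = i + 1 := by omega
            rw [oo_le k h2]
            omega
          · rw [oo_gt k (by omega)]
            omega
      · intro t ht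
        by_cases hti : t.val = i
        · subst hti
          exact hv2
        · have h3 := psum_mono k (show t.val + 1 ≤ i by omega)
          have h4 := psum_succ k t
          rw [← hw2 t (by omega), ← hv1,
            R_R X (good_dl (by omega) (by omega)) (good_add (by omega))]
          apply R_congr
          intro j hj
          simp only [dl]
          split_ifs <;> omega
  obtain ⟨w, hw1, hw2⟩ := main n le_rfl
  have hl := psum_last k
  refine ⟨R X _ _ (fun j => j) w, ?_, ?_⟩
  · rw [← hw1, R_R X (good_id (by omega)) (good_psum k)]
    apply R_congr
    intro j hj
    simp only [oo]
    split_ifs; rfl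
  · intro i
    rw [← hw2 i i.isLt, R_R X (good_id (by omega)) (good_inner k i)]

theorem linj_of_glue (X : SSet) (H : G2 X) (n : ℕ) (k : Fin n → ℕ) : LInj X n k := by
  intro x x' ho hi'
  have main : ∀ i ≤ n, R X (psum k i + (n - i)) _ (rho k i) x =
      R X (psum k i + (n - i)) _ (rho k i) x' := by
    intro i
    induction i with
    | zero =>
      intro _
      have h0 := psum_zero k
      have := congrArg (R X (psum k 0 + (n - 0)) n (fun j => j)) ho
      rw [R_R X (good_psum k) (good_id (by omega)), R_R X (good_psum k) (good_id (by omega))] at this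
      refine (R_congr X x ?_).trans (this.trans (R_congr X x' ?_))
      all_goals
        intro j hj
        simp only [rho]
        split_ifs with h
        · obtain rfl : j = 0 := by omega
          omega
        · congr 1; omega
    | succ i ih =>
      intro hi
      have hs := psum_succ k ⟨i, by omega⟩
      dsimp only at hs
      have hg := (glue_all X H (k ⟨i, by omega⟩) (psum k i + (n - i)) (psum k i)
        (psum k (i + 1) + (n - (i + 1))) (by omega) (by omega)).1
      have e1 : ∀ u : XS X (∑ t, k t), R X (psum k i + (n - i)) (psum k (i + 1) + (n - (i + 1)))
          (dl (psum k i) (k ⟨i, by omega⟩)) (R X _ _ (rho k (i + 1)) u) =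
          R X (psum k i + (n - i)) _ (rho k i) u := by
        intro u
        apply R_R' X _ (good_rho k _ _) (good_dl (by omega) (by omega))
        intro j hj
        by_cases h1 : j ≤ psum k i
        · rw [dl_le h1]
          simp only [rho]
          rw [if_pos h1, if_pos (by omega)]
        · rw [dl_gt (by omega)]
          simp only [rho]
          rw [if_neg h1]
          split_ifs with h2
          · rw [show i + (j - psum k i) = i + 1 by omega]
            omega
          · congr 1; omega
      have e2 : ∀ u : XS X (∑ t, k t), R X (k ⟨i, by omega⟩) (psum k (i + 1) + (n - (i + 1)))
          (fun j => psum k i + j) (R X _ _ (rho k (i + 1)) u) =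
          R X (k ⟨i, by omega⟩) _ (fun j => psum k i + j) u := by
        intro u
        apply R_R' X _ (good_rho k _ _) (good_add (by omega))
        intro j hj
        simp only [rho]
        rw [if_pos (by omega)]
      apply hg
      · rw [e1, e1]
        exact ih (by omega)
      · rw [e2, e2]
        exact hi' ⟨i, by omega⟩
  have hl := psum_last k
  have := congrArg (R X (∑ t, k t) _ (fun j => j)) (main n le_rfl)
  rw [R_R X (good_rho k _ _) (good_id (by omega)), R_R X (good_rho k _ _) (good_id (by omega)),
    R_id, R_id] at this
  · exact this
  all_goals
    intro j hj
    simp only [rho]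
    rw [if_pos (by omega)]

theorem g2_of_l (X : SSet) (H : ∀ n k, LInj X n k ∧ LSurj X n k) : G2 X := by
  intro m a ha
  let k : Fin m → ℕ := fun i => if i.val = a then 2 else 1
  have hk : ∀ j ≤ m, psum k j = dl a 2 j := by
    intro j
    induction j with
    | zero => intro _; simp [psum_zero, dl]
    | succ j ih =>
      intro hj
      have h1 := psum_succ k ⟨j, by omega⟩
      dsimp only at h1
      rw [h1, ih (by omega)]
      simp only [dl, k]
      split_ifs <;> omega
  have hN : ∑ t, k t = m + 1 := by
    rw [← psum_last, hk m le_rfl]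
    simp only [dl]
    split_ifs <;> omega
  obtain ⟨hI, hS⟩ := H m k
  unfold LInj at hI
  unfold LSurj at hS
  rw [hN] at hI hS
  have hka : k ⟨a, ha⟩ = 2 := by simp [k]
  have hpa : psum k a = a := by rw [hk a (by omega)]; simp [dl]
  have gP : Good m (m + 1) (dl a 2) := good_dl (by omega) ha
  constructor
  · intro v v' h1 h2
    apply hI
    · refine (R_congr X v ?_).trans (h1.trans (R_congr X v' ?_))
      · exact hk
      · intro j hj; exact (hk j hj).symm
    · intro i
      by_cases hia : i.val = a
      · obtain rfl : i = ⟨a, ha⟩ := Fin.ext hia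
        dsimp only
        rw [hka, hpa]
        exact h2
      · have hki : k i = 1 := by simp [k, hia]
        rw [hki]
        have := congrArg (R X 1 m (fun j => i.val + j)) h1
        rw [R_R X gP (good_add (by omega)), R_R X gP (good_add (by omega))] at this
        refine (R_congr X v ?_).trans (this.trans (R_congr X v' ?_))
        all_goals
          intro j hj
          rw [hk i.val (by omega)]
          simp only [dl]
          split_ifs <;> omega
  · intro w z hz
    obtain ⟨v, hv1, hv2⟩ := hS w
      (fun i => if i.val = a then R X (k i) 2 (fun j => j) z else R X (k i) m (fun j => i.val + j) w)
      (by
        intro i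
        by_cases hia : i.val = a
        · have hki : k i = 2 := by simp [k, hia]
          rw [if_pos hia, hki, hia, ← hz, R_ed X (good_id (by omega)) (by omega) (by omega)]
        · have hki : k i = 1 := by simp [k, hia]
          rw [if_neg hia, hki, R_ed X (good_add (by omega)) (by omega) (by omega)]
          rfl)
    refine ⟨v, ?_, ?_⟩
    · rw [← hv1]
      apply R_congr
      intro j hj
      exact (hk j hj).symm
    · have := hv2 ⟨a, ha⟩
      dsimp only at this
      rw [if_pos rfl, hka, hpa] at this
      rw [this, R_id]
      intro j _
      rfl

/-- The left side of the theorem is the colour-free statement. -/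
def LHS.{u} (X : SSet) : Prop :=
    ((∀ c0 : XS X 1,
        Function.Bijective (fun _ : QX X 1 (fun _ => c0) c0 => PUnit.unit.{u})) ∧
     (∀ (n : ℕ) (k : Fin n → ℕ) (c0 : XS X 1)
        (d : ∀ i : Fin n, Fin (k i) → XS X 1) (c' : Fin (∑ t, k t) → XS X 1),
        (∀ (i : Fin n) (r : Fin (k i)),
          c' ⟨psum k i.val + r.val,
            psum_add_le k i (r.val + 1) r.isLt⟩ = d i r) →
        Function.Injective (fun x : QX X (∑ t, k t) c' c0 =>
            (X.map (outerHom k).op x.1, fun i => X.map (innerHom k i).op x.1)) ∧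
        (∀ (y : XS X n) (z : ∀ i, XS X (k i)),
          sEdge X 0 (Fin.last n) (Fin.zero_le _) y = c0 →
          (∀ (i : Fin n) (r : Fin (k i)),
            sEdge X r.castSucc r.succ (Fin.castSucc_le_succ r) (z i) = d i r) →
          (∀ i : Fin n, sEdge X 0 (Fin.last (k i)) (Fin.zero_le _) (z i) =
            sEdge X i.castSucc i.succ (Fin.castSucc_le_succ i) y) →
          ∃ x : QX X (∑ t, k t) c' c0,
            X.map (outerHom k).op x.1 = y ∧
              ∀ i, X.map (innerHom k i).op x.1 = z i)))

theorem long_eq (X : SSet) {n : ℕ} (k : Fin n → ℕ) (x : XS X (∑ t, k t)) :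
    R X 1 n (ed 0 n) (R X n _ (psum k) x) = R X 1 _ (ed 0 (∑ t, k t)) x := by
  rw [R_ed X (good_psum k) (by omega) (by omega), psum_zero, psum_last]

theorem short_eq (X : SSet) {n : ℕ} (k : Fin n → ℕ) (x : XS X (∑ t, k t)) (i : Fin n)
    (r : ℕ) (hr : r < k i) :
    R X 1 (k i) (ed r (r + 1)) (R X (k i) _ (fun j => psum k i.val + j) x) =
      R X 1 _ (ed (psum k i.val + r) (psum k i.val + r + 1)) x := by
  rw [R_ed X (good_inner k i) (by omega) (by omega)]
  rfl

theorem lhs_of_l.{u} (X : SSet) (H : ∀ n k, LInj X n k ∧ LSurj X n k) : LHS.{u} X := by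
  constructor
  · intro c0
    have hid : ∀ x : XS X 1, R X 1 1 (ed 0 1) x = x := by
      intro x
      apply R_id
      intro j hj
      simp only [ed]
      split_ifs <;> omega
    constructor
    · intro x x' _
      apply Subtype.ext
      have h1 := x.2.2
      have h2 := x'.2.2
      rw [sEdge_eq] at h1 h2
      have h3 := (hid x.1).symm.trans h1
      have h4 := (hid x'.1).symm.trans h2
      exact h3.trans h4.symm
    · intro _
      refine ⟨⟨c0, ?_, ?_⟩, rfl⟩
      · intro i
        obtain rfl : i = 0 := Subsingleton.elim _ _
        rw [sEdge_eq]
        exact hid c0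
      · rw [sEdge_eq]
        exact hid c0
  · intro n k c0 d c' hc
    obtain ⟨hI, hS⟩ := H n k
    constructor
    · intro x x' h
      apply Subtype.ext
      simp only [Prod.mk.injEq, outer_eq, inner_eq] at h
      exact hI x.1 x'.1 h.1 (fun i => congrFun h.2 i)
    · intro y z hy hz hyz
      obtain ⟨x, hx1, hx2⟩ := hS y z (by
        intro i
        have := hyz i
        rw [sEdge_eq, sEdge_eq] at this
        exact this)
      refine ⟨⟨x, ?_, ?_⟩, ?_, ?_⟩
      · intro t
        obtain ⟨i, r, htr⟩ := psum_decomp k n le_rfl t.val (by rw [psum_last]; exact t.isLt)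
        have e := hc i r
        rw [show (⟨psum k i.val + r.val, by rw [← htr]; exact t.isLt⟩ : Fin (∑ t, k t)) = t from
          Fin.ext htr.symm] at e
        rw [e, ← hz, ← hx2, sEdge_eq, sEdge_eq]
        have := short_eq X k x i r.val r.isLt
        rw [← htr] at this
        exact this.symm
      · rw [← hy, ← hx1, sEdge_eq, sEdge_eq]
        exact (long_eq X k x).symm
      · rw [outer_eq]; exact hx1
      · intro i
        rw [inner_eq]; exact hx2 i

theorem l_of_lhs.{u} (X : SSet) (H : LHS.{u} X) : ∀ n k, LInj X n k ∧ LSurj X n k := by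
  intro n k
  have H2 := H.2 n k
  constructor
  · intro x x' ho hi
    let c' : Fin (∑ t, k t) → XS X 1 := fun t => R X 1 _ (ed t.val (t.val + 1)) x
    have h := (H2 (R X 1 _ (ed 0 (∑ t, k t)) x)
      (fun i r => c' ⟨psum k i.val + r.val,
            psum_add_le k i (r.val + 1) r.isLt⟩) c' (fun _ _ => rfl)).1
    have hx : ∀ t : Fin (∑ t, k t), sEdge X t.castSucc t.succ (Fin.castSucc_le_succ t) x = c' t := by
      intro t
      rw [sEdge_eq]; rfl
    have hx' : ∀ t : Fin (∑ t, k t), sEdge X t.castSucc t.succ (Fin.castSucc_le_succ t) x' = c' t := by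
      intro t
      rw [sEdge_eq]
      obtain ⟨i, r, htr⟩ := psum_decomp k n le_rfl t.val (by rw [psum_last]; exact t.isLt)
      have e1 := short_eq X k x i r.val r.isLt
      have e2 := short_eq X k x' i r.val r.isLt
      rw [← htr] at e1 e2
      rw [hi] at e1
      exact e2.symm.trans e1
    have := @h ⟨x, hx, by rw [sEdge_eq]; rfl⟩ ⟨x', hx', by
      rw [sEdge_eq, ← long_eq X k x, ho]; exact (long_eq X k x').symm⟩ (by
        simp only [Prod.mk.injEq, outer_eq, inner_eq]
        exact ⟨ho, funext hi⟩)
    exact congrArg Subtype.val this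
  · intro y z hyz
    let d : ∀ i : Fin n, Fin (k i) → XS X 1 := fun i r => R X 1 _ (ed r.val (r.val + 1)) (z i)
    let φ : (Σ i : Fin n, Fin (k i)) → Fin (∑ t, k t) := fun p => ⟨psum k p.1.val + p.2.val,
            by have := psum_add_le k p.1 (p.2.val + 1) p.2.isLt; omega⟩
    have hφ : Function.Injective φ := by
      rintro ⟨i, r⟩ ⟨i', r'⟩ h
      have h1 : psum k i.val + r.val = psum k i'.val + r'.val := congrArg Fin.val h
      have h2 := psum_succ k i
      have h3 := psum_succ k i'
      have h4 := r.isLt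
      have h5 := r'.isLt
      have h6 : i = i' := by
        rcases lt_trichotomy i.val i'.val with h | h | h
        · have := psum_mono k (show i.val + 1 ≤ i'.val from h)
          omega
        · exact Fin.ext h
        · have := psum_mono k (show i'.val + 1 ≤ i.val from h)
          omega
      subst h6
      have : r = r' := Fin.ext (by omega)
      rw [this]
    obtain ⟨x, hx1, hx2⟩ := (H2 (R X 1 _ (ed 0 n) y) d
      (Function.extend φ (fun p => d p.1 p.2) (fun _ => R X 1 _ (ed 0 n) y)) (by
        intro i r
        exact hφ.extend_apply (fun p => d p.1 p.2) _ ⟨i, r⟩)).2 y z (by rw [sEdge_eq]; rfl)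
          (by intro i r; rw [sEdge_eq]; rfl) (by
            intro i
            rw [sEdge_eq, sEdge_eq]
            exact hyz i)
    refine ⟨x.1, ?_, ?_⟩
    · rw [← outer_eq]; exact hx1
    · intro i
      rw [← inner_eq]; exact hx2 i

theorem lhs_iff_g2.{u} (X : SSet) : LHS.{u} X ↔ G2 X :=
  ⟨fun h => g2_of_l X (l_of_lhs X h),
    fun h => lhs_of_l X (fun n k => ⟨linj_of_glue X h n k, lsurj_of_glue X h n k⟩)⟩

/-- Edges, over the naturals. -/
def EE (n : ℕ) (D : Finset (ℕ × ℕ)) (p q : ℕ) : Prop :=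
  p < q ∧ q ≤ n ∧ (q = p + 1 ∨ (p = 0 ∧ q = n) ∨ (p, q) ∈ D)

/-- Triangles, over the naturals. -/
def TT (n : ℕ) (D : Finset (ℕ × ℕ)) (x y z : ℕ) : Prop :=
  EE n D x y ∧ EE n D y z ∧ EE n D x z

/-- Injectivity of the Segal map. -/
def InjT (X : SSet) (n : ℕ) (D : Finset (ℕ × ℕ)) : Prop :=
  ∀ x x' : XS X n, (∀ a b c, TT n D a b c → R X 2 n (tr a b c) x = R X 2 n (tr a b c) x') → x = x'

def Cmp (X : SSet) (n : ℕ) (D : Finset (ℕ × ℕ)) (g : ℕ → ℕ → XS X 1)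
    (f : ℕ → ℕ → ℕ → XS X 2) : Prop :=
  ∀ a b c, TT n D a b c → R X 1 2 (ed 0 1) (f a b c) = g a b ∧
    R X 1 2 (ed 1 2) (f a b c) = g b c ∧ R X 1 2 (ed 0 2) (f a b c) = g a c

/-- Surjectivity of the Segal map. -/
def SurjT (X : SSet) (n : ℕ) (D : Finset (ℕ × ℕ)) : Prop :=
  ∀ g f, Cmp X n D g f → ∃ x : XS X n, ∀ a b c, TT n D a b c → R X 2 n (tr a b c) x = f a b c

/-- Surjectivity of the Segal map, recording edges too. -/
def SurjS (X : SSet) (n : ℕ) (D : Finset (ℕ × ℕ)) : Prop :=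
  ∀ g f, Cmp X n D g f → ∃ x : XS X n, (∀ a b c, TT n D a b c → R X 2 n (tr a b c) x = f a b c) ∧
    ∀ a b, EE n D a b → R X 1 n (ed a b) x = g a b

/-- `D` is obtained from `D'` by attaching an ear at the edge `(a, a+1)`. -/
def Ear (m a : ℕ) (D D' : Finset (ℕ × ℕ)) : Prop :=
  a < m ∧ ∀ p q, EE (m + 1) D p q ↔ (p = a ∧ q = a + 1) ∨ (p = a + 1 ∧ q = a + 2) ∨
    ∃ p' q', EE m D' p' q' ∧ p = dl a 2 p' ∧ q = dl a 2 q'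

def sg (a : ℕ) : ℕ → ℕ := fun p => if p ≤ a then p else p - 1

theorem sg_dl (a p : ℕ) : sg a (dl a 2 p) = p := by
  by_cases h : p ≤ a
  · rw [dl_le h]; exact if_pos h
  · rw [dl_gt (by omega)]
    simp only [sg]
    rw [if_neg (by omega)]
    omega

theorem dl_inj {a p q : ℕ} (h : dl a 2 p = dl a 2 q) : p = q := by
  rw [← sg_dl a p, h, sg_dl]

theorem dl_ne (a p : ℕ) : dl a 2 p ≠ a + 1 := by
  simp only [dl]
  split_ifs <;> omega

theorem Ear.tri {m a : ℕ} {D D' : Finset (ℕ × ℕ)} (h : Ear m a D D') {x y z : ℕ}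
    (ht : TT (m + 1) D x y z) : (x = a ∧ y = a + 1 ∧ z = a + 2) ∨
    ∃ x' y' z', TT m D' x' y' z' ∧ x = dl a 2 x' ∧ y = dl a 2 y' ∧ z = dl a 2 z' := by
  obtain ⟨h1, h2, h3⟩ := ht
  have l1 := h1.1
  have l2 := h2.1
  rw [h.2] at h1 h2 h3
  rcases h1 with ⟨rfl, rfl⟩ | ⟨rfl, rfl⟩ | ⟨p1, q1, e1, rfl, rfl⟩
  · rcases h2 with ⟨h, rfl⟩ | ⟨-, rfl⟩ | ⟨p2, q2, e2, h, rfl⟩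
    · omega
    · left; omega
    · exact absurd h.symm (dl_ne _ _)
  · rcases h3 with ⟨h, rfl⟩ | ⟨-, rfl⟩ | ⟨p2, q2, e2, h, rfl⟩
    · omega
    · omega
    · exact absurd h.symm (dl_ne _ _)
  · rcases h3 with ⟨h, rfl⟩ | ⟨h, rfl⟩ | ⟨p3, q3, e3, h, rfl⟩
    · rcases h2 with ⟨h', -⟩ | ⟨h', h''⟩ | ⟨p2, q2, e2, h', h''⟩
      · omega
      · omega
      · exact absurd h''.symm (dl_ne _ _)
    · exact absurd h (dl_ne _ _)
    · rcases h2 with ⟨h', h''⟩ | ⟨h', h''⟩ | ⟨p2, q2, e2, h', h''⟩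
      · exact absurd h'' (dl_ne _ _)
      · exact absurd h' (dl_ne _ _)
      · have i1 := dl_inj h
        have i2 := dl_inj h'
        have i3 := dl_inj h''
        subst i1 i2 i3
        exact Or.inr ⟨_, _, _, ⟨e1, e2, e3⟩, rfl, rfl, rfl⟩

theorem Ear.tri_dl {m a : ℕ} {D D' : Finset (ℕ × ℕ)} (h : Ear m a D D') {x y z : ℕ}
    (ht : TT m D' x y z) : TT (m + 1) D (dl a 2 x) (dl a 2 y) (dl a 2 z) :=
  ⟨(h.2 _ _).2 (Or.inr (Or.inr ⟨_, _, ht.1, rfl, rfl⟩)),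
    (h.2 _ _).2 (Or.inr (Or.inr ⟨_, _, ht.2.1, rfl, rfl⟩)),
    (h.2 _ _).2 (Or.inr (Or.inr ⟨_, _, ht.2.2, rfl, rfl⟩))⟩

theorem Ear.tri_ear {m a : ℕ} {D D' : Finset (ℕ × ℕ)} (h : Ear m a D D') :
    TT (m + 1) D a (a + 1) (a + 2) :=
  ⟨(h.2 _ _).2 (Or.inl ⟨rfl, rfl⟩), (h.2 _ _).2 (Or.inr (Or.inl ⟨rfl, rfl⟩)),
    (h.2 _ _).2 (Or.inr (Or.inr ⟨a, a + 1, ⟨by omega, by have := h.1; omega, Or.inl rfl⟩,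
      (dl_le le_rfl).symm, (dl_gt (l := 2) (Nat.lt_succ_self a)).symm⟩))⟩

theorem ear_R (X : SSet) {a M : ℕ} (v : XS X M) :
    R X 2 M (fun j => a + j) v = R X 2 M (tr a (a + 1) (a + 2)) v := by
  apply R_congr
  intro j hj
  simp only [tr]
  split_ifs <;> omega

theorem Ear.inj (X : SSet) {m a : ℕ} {D D' : Finset (ℕ × ℕ)} (h : Ear m a D D')
    (hG : GU X m a 2 (m + 1)) (hI : InjT X m D') : InjT X (m + 1) D := by
  intro x x' hx
  have gd : Good m (m + 1) (dl a 2) := good_dl (by omega) h.1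
  apply hG
  · apply hI
    intro p q r ht
    rw [R_tr X gd ht.1.1.le ht.2.1.1.le ht.2.1.2.1, R_tr X gd ht.1.1.le ht.2.1.1.le ht.2.1.2.1]
    exact hx _ _ _ (h.tri_dl ht)
  · rw [ear_R, ear_R]
    exact hx _ _ _ h.tri_ear

theorem Ear.surj (X : SSet) {m a : ℕ} {D D' : Finset (ℕ × ℕ)} (h : Ear m a D D')
    (hG : GE X m a 2 (m + 1)) (hS : SurjS X m D') : SurjS X (m + 1) D := by
  intro g f hgf
  have ha := h.1
  have gd : Good m (m + 1) (dl a 2) := good_dl (by omega) h.1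
  have ga : Good 2 (m + 1) (fun j => a + j) := good_add (by omega)
  obtain ⟨w, hw1, hw2⟩ := hS (fun p q => g (dl a 2 p) (dl a 2 q))
    (fun p q r => f (dl a 2 p) (dl a 2 q) (dl a 2 r)) (by
      intro p q r ht
      exact hgf _ _ _ (h.tri_dl ht))
  have he := hgf _ _ _ h.tri_ear
  obtain ⟨v, hv1, hv2⟩ := hG w (f a (a + 1) (a + 2)) (by
    rw [he.2.2, hw2 a (a + 1) ⟨by omega, by omega, Or.inl rfl⟩, dl_le le_rfl, dl_gt (by omega)]
    rfl)
  refine ⟨v, ?_, ?_⟩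
  · intro p q r ht
    rcases h.tri ht with ⟨rfl, rfl, rfl⟩ | ⟨p', q', r', ht', rfl, rfl, rfl⟩
    · rw [← ear_R, hv2]
    · rw [← R_tr X gd ht'.1.1.le ht'.2.1.1.le ht'.2.1.2.1, hv1]
      exact hw1 _ _ _ ht'
  · intro p q hpq
    rcases (h.2 _ _).1 hpq with ⟨rfl, rfl⟩ | ⟨rfl, rfl⟩ | ⟨p', q', e, rfl, rfl⟩
    · rw [← he.1, ← hv2, R_ed X ga (by omega) (by omega)]
      rfl
    · rw [← he.2.1, ← hv2, R_ed X ga (by omega) (by omega)]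
    · rw [← R_ed X gd e.1.le e.2.1, hv1]
      exact hw2 _ _ e

theorem Ear.gu (X : SSet) {m a : ℕ} {D D' : Finset (ℕ × ℕ)} (h : Ear m a D D')
    (hI : InjT X (m + 1) D) : GU X m a 2 (m + 1) := by
  intro v v' h1 h2
  have gd : Good m (m + 1) (dl a 2) := good_dl (by omega) h.1
  apply hI
  intro p q r ht
  rcases h.tri ht with ⟨rfl, rfl, rfl⟩ | ⟨p', q', r', ht', rfl, rfl, rfl⟩
  · rw [← ear_R, ← ear_R, h2]
  · rw [← R_tr X gd ht'.1.1.le ht'.2.1.1.le ht'.2.1.2.1,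
      ← R_tr X gd ht'.1.1.le ht'.2.1.1.le ht'.2.1.2.1, h1]

theorem Ear.ge (X : SSet) {m a : ℕ} {D D' : Finset (ℕ × ℕ)} (h : Ear m a D D')
    (hI : InjT X m D') (hS : SurjT X (m + 1) D) : GE X m a 2 (m + 1) := by
  intro w t hwt
  have ha := h.1
  have gd : Good m (m + 1) (dl a 2) := good_dl (by omega) h.1
  obtain ⟨v, hv⟩ := hS
    (fun p q => if p = a + 1 then R X 1 2 (ed 1 2) t else if q = a + 1 then R X 1 2 (ed 0 1) t
      else R X 1 m (ed (sg a p) (sg a q)) w)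
    (fun p q r => if q = a + 1 then t else R X 2 m (tr (sg a p) (sg a q) (sg a r)) w) (by
      intro p q r ht
      rcases h.tri ht with ⟨rfl, rfl, rfl⟩ | ⟨p', q', r', ht', rfl, rfl, rfl⟩
      · dsimp only
        have n1 : ¬ (p = p + 1) := by omega
        have n2 : ¬ (p + 2 = p + 1) := by omega
        simp only [if_true, if_neg n1, if_neg n2]
        refine ⟨trivial, trivial, ?_⟩
        rw [hwt, show sg p p = p from if_pos le_rfl, show sg p (p + 2) = p + 1 from if_neg (by omega)]
      · simp only [if_neg (dl_ne _ _), sg_dl]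
        have gt : Good 2 m (tr p' q' r') := good_tr ht'.1.1.le ht'.2.1.1.le ht'.2.1.2.1
        rw [R_ed X gt (by omega) (by omega), R_ed X gt (by omega) (by omega),
          R_ed X gt (by omega) (by omega)]
        exact ⟨rfl, rfl, rfl⟩)
  refine ⟨v, ?_, ?_⟩
  · apply hI
    intro p q r ht
    rw [R_tr X gd ht.1.1.le ht.2.1.1.le ht.2.1.2.1, hv _ _ _ (h.tri_dl ht)]
    simp only [if_neg (dl_ne _ _), sg_dl]
  · rw [ear_R, hv _ _ _ h.tri_ear]
    exact if_pos rfl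

theorem base_tri {D : Finset (ℕ × ℕ)} : TT 2 D 0 1 2 :=
  ⟨⟨by omega, by omega, Or.inl rfl⟩, ⟨by omega, by omega, Or.inl rfl⟩,
    ⟨by omega, by omega, Or.inr (Or.inl ⟨rfl, rfl⟩)⟩⟩

theorem base_R (X : SSet) (x : XS X 2) : R X 2 2 (tr 0 1 2) x = x := by
  apply R_id
  intro j hj
  simp only [tr]
  split_ifs <;> omega

theorem base_inj (X : SSet) (D : Finset (ℕ × ℕ)) : InjT X 2 D := by
  intro x x' h
  have := h 0 1 2 base_tri
  rwa [base_R, base_R] at this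

theorem base_surj (X : SSet) (D : Finset (ℕ × ℕ)) : SurjS X 2 D := by
  intro g f h
  have h0 := h 0 1 2 base_tri
  refine ⟨f 0 1 2, ?_, ?_⟩
  · intro a b c ht
    have h1 := ht.1.1
    have h2 := ht.2.1.1
    have h3 := ht.2.1.2.1
    obtain ⟨rfl, rfl, rfl⟩ : a = 0 ∧ b = 1 ∧ c = 2 := by omega
    exact base_R X _
  · intro a b he
    have h1 := he.1
    have h2 := he.2.1
    obtain ⟨rfl, rfl⟩ | ⟨rfl, rfl⟩ | ⟨rfl, rfl⟩ :
      (a = 0 ∧ b = 1) ∨ (a = 1 ∧ b = 2) ∨ (a = 0 ∧ b = 2) := by omega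
    · exact h0.1
    · exact h0.2.1
    · exact h0.2.2

/-- Non-crossing sets of diagonals. -/
def NC (n : ℕ) (D : Finset (ℕ × ℕ)) : Prop :=
  (∀ p ∈ D, p.1 + 1 < p.2 ∧ p.2 ≤ n ∧ ¬(p.1 = 0 ∧ p.2 = n)) ∧
  ∀ p ∈ D, ∀ q ∈ D, ¬(p.1 < q.1 ∧ q.1 < p.2 ∧ p.2 < q.2)

/-- Contraction of the vertex `a + 1`. -/
def contr (a : ℕ) (D : Finset (ℕ × ℕ)) : Finset (ℕ × ℕ) :=
  (D.erase (a, a + 2)).image (fun p => (sg a p.1, sg a p.2))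

theorem dl_sg {a p : ℕ} (h : p ≠ a + 1) : dl a 2 (sg a p) = p := by
  by_cases h1 : p ≤ a
  · rw [show sg a p = p from if_pos h1, dl_le h1]
  · rw [show sg a p = p - 1 from if_neg h1, dl_gt (by omega)]
    omega

/-- No diagonal ends at `v`. -/
def FreeV (v : ℕ) (D : Finset (ℕ × ℕ)) : Prop := ∀ p ∈ D, p.1 ≠ v ∧ p.2 ≠ v

theorem contr_card {a : ℕ} {D : Finset (ℕ × ℕ)} (h : FreeV (a + 1) D) :
    (contr a D).card = (D.erase (a, a + 2)).card := by
  apply Finset.card_image_of_injOn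
  rintro ⟨p, q⟩ hp ⟨p', q'⟩ hp' he
  have h1 := h _ (Finset.mem_of_mem_erase hp)
  have h2 := h _ (Finset.mem_of_mem_erase hp')
  simp only [Prod.mk.injEq] at he h1 h2
  ext
  · dsimp only; rw [← dl_sg h1.1, he.1, dl_sg h2.1]
  · dsimp only; rw [← dl_sg h1.2, he.2, dl_sg h2.2]

theorem contr_mem {a : ℕ} {D : Finset (ℕ × ℕ)} (h : FreeV (a + 1) D) (p q : ℕ) :
    (p, q) ∈ contr a D ↔ (dl a 2 p, dl a 2 q) ∈ D ∧ ¬(p = a ∧ q = a + 1) := by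
  simp only [contr, Finset.mem_image, Finset.mem_erase, Prod.exists, Prod.mk.injEq, ne_eq]
  constructor
  · rintro ⟨x, y, ⟨h1, h2⟩, rfl, rfl⟩
    have h3 := h _ h2
    dsimp only at h3
    rw [dl_sg h3.1, dl_sg h3.2]
    refine ⟨h2, ?_⟩
    rintro ⟨h4, h5⟩
    apply h1
    have h6 := dl_sg h3.1
    have h7 := dl_sg h3.2
    rw [h4, dl_le le_rfl] at h6
    rw [h5, dl_gt (by omega)] at h7
    omega
  · rintro ⟨h1, h2⟩
    refine ⟨_, _, ⟨?_, h1⟩, sg_dl _ _, sg_dl _ _⟩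
    rintro ⟨h3, h4⟩
    apply h2
    constructor
    · rw [← sg_dl a p, h3]; exact if_pos le_rfl
    · rw [← sg_dl a q, h4]; exact if_neg (by omega)

theorem dl_lt_iff (a p q : ℕ) : dl a 2 p < dl a 2 q ↔ p < q := by
  simp only [dl]
  split_ifs <;> omega

theorem contr_nc {m a : ℕ} {D : Finset (ℕ × ℕ)} (ha : a < m) (hD : NC (m + 1) D)
    (h : FreeV (a + 1) D) : NC m (contr a D) := by
  constructor
  · rintro ⟨p, q⟩ hp
    rw [contr_mem h] at hp
    have h1 := hD.1 _ hp.1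
    have h2 := hp.2
    simp only [dl] at h1 ⊢
    split_ifs at h1 <;> omega
  · rintro ⟨p, q⟩ hp ⟨p', q'⟩ hp'
    rw [contr_mem h] at hp hp'
    have h1 := hD.2 _ hp.1 _ hp'.1
    dsimp only at h1 ⊢
    rwa [dl_lt_iff, dl_lt_iff, dl_lt_iff] at h1

/-- A shortest diagonal yields a free vertex. -/
theorem exists_free {n : ℕ} {D : Finset (ℕ × ℕ)} (hD : NC n D) (hne : D.Nonempty) :
    ∃ a, a + 2 ≤ n ∧ FreeV (a + 1) D := by
  obtain ⟨⟨a, b⟩, hab, hmin⟩ := Finset.exists_min_image D (fun p => p.2 - p.1) hne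
  have h0 := hD.1 _ hab
  dsimp only at h0 hmin
  refine ⟨a, by omega, ?_⟩
  rintro ⟨p, q⟩ hp
  have h1 := hD.1 _ hp
  have h2 := hmin _ hp
  have h3 := hD.2 _ hp _ hab
  have h4 := hD.2 _ hab _ hp
  dsimp only at *
  omega

theorem nc_card {n : ℕ} : ∀ {D : Finset (ℕ × ℕ)}, NC n D → D.card ≤ n - 2 := by
  induction n with
  | zero =>
    intro D hD
    rcases D.eq_empty_or_nonempty with rfl | hne
    · simp
    · obtain ⟨a, h, _⟩ := exists_free hD hne
      omega
  | succ n ih =>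
    intro D hD
    rcases D.eq_empty_or_nonempty with rfl | hne
    · simp
    · obtain ⟨a, h, hf⟩ := exists_free hD hne
      have h1 := ih (contr_nc (by omega) hD hf)
      rw [contr_card hf] at h1
      have h2 := Finset.pred_card_le_card_erase (s := D) (a := (a, a + 2))
      obtain ⟨p, hp⟩ := hne
      have := hD.1 p hp
      omega

theorem exists_ear {m : ℕ} (hm : 2 ≤ m) {D : Finset (ℕ × ℕ)} (hD : NC (m + 1) D)
    (hc : D.card = m + 1 - 2) : ∃ a D', NC m D' ∧ D'.card = m - 2 ∧ Ear m a D D' := by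
  have hne : D.Nonempty := Finset.card_pos.mp (by omega)
  obtain ⟨a, h, hf⟩ := exists_free hD hne
  have hn := contr_nc (by omega) hD hf
  have h1 := nc_card hn
  have h2 := contr_card hf
  have hmem : (a, a + 2) ∈ D := by
    by_contra hcon
    rw [Finset.erase_eq_of_notMem hcon] at h2
    omega
  rw [Finset.card_erase_of_mem hmem] at h2
  refine ⟨a, contr a D, hn, by omega, by omega, ?_⟩
  intro p q
  constructor
  · rintro ⟨e1, e2, e3⟩
    by_cases hpa : p = a + 1
    · rcases e3 with e3 | e3 | e3
      · right; left; omega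
      · omega
      · exact absurd hpa (hf _ e3).1
    · by_cases hqa : q = a + 1
      · rcases e3 with e3 | e3 | e3
        · left; omega
        · omega
        · exact absurd hqa (hf _ e3).2
      · right; right
        refine ⟨sg a p, sg a q, ⟨?_, ?_, ?_⟩, (dl_sg hpa).symm, (dl_sg hqa).symm⟩
        · rw [← dl_lt_iff a, dl_sg hpa, dl_sg hqa]; exact e1
        · simp only [sg]; split_ifs <;> omega
        · rw [contr_mem hf, dl_sg hpa, dl_sg hqa]
          rcases e3 with e3 | e3 | e3
          · left; simp only [sg]; split_ifs <;> omega
          · right; left; simp only [sg]; split_ifs <;> omega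
          · by_cases h9 : sg a p = a ∧ sg a q = a + 1
            · left; omega
            · exact Or.inr (Or.inr ⟨e3, h9⟩)
  · rintro (⟨rfl, rfl⟩ | ⟨rfl, rfl⟩ | ⟨p', q', ⟨e1, e2, e3⟩, rfl, rfl⟩)
    · exact ⟨by omega, by omega, Or.inl rfl⟩
    · exact ⟨by omega, by omega, Or.inl rfl⟩
    · refine ⟨(dl_lt_iff _ _ _).2 e1, ?_, ?_⟩
      · simp only [dl]; split_ifs <;> omega
      · rw [contr_mem hf] at e3
        rcases e3 with e3 | e3 | e3
        · by_cases h9 : p' = a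
          · right; right
            rw [e3, h9, dl_le le_rfl, dl_gt (by omega)]
            exact hmem
          · left; simp only [dl]; split_ifs <;> omega
        · right; left; simp only [dl]; split_ifs <;> omega
        · exact Or.inr (Or.inr e3.1)

/-- Attaching an ear. -/
def att (a : ℕ) (D : Finset (ℕ × ℕ)) : Finset (ℕ × ℕ) :=
  insert (a, a + 2) (D.image (fun p => (dl a 2 p.1, dl a 2 p.2)))

theorem att_mem {a : ℕ} {D : Finset (ℕ × ℕ)} {p q : ℕ} : (p, q) ∈ att a D ↔
    (p = a ∧ q = a + 2) ∨ ∃ p' q', (p', q') ∈ D ∧ p = dl a 2 p' ∧ q = dl a 2 q' := by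
  simp [att, eq_comm]

theorem att_nc {m a : ℕ} (hm : 2 ≤ m) (ha : a < m) {D : Finset (ℕ × ℕ)} (hD : NC m D) :
    NC (m + 1) (att a D) := by
  constructor
  · rintro ⟨p, q⟩ hp
    rw [att_mem] at hp
    rcases hp with ⟨rfl, rfl⟩ | ⟨p', q', h, rfl, rfl⟩
    · dsimp only; omega
    · have := hD.1 _ h
      simp only [dl] at this ⊢
      split_ifs <;> omega
  · rintro ⟨p, q⟩ hp ⟨p2, q2⟩ hp2
    rw [att_mem] at hp hp2
    dsimp only
    rcases hp with ⟨rfl, rfl⟩ | ⟨p', q', h, rfl, rfl⟩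
    · rcases hp2 with ⟨rfl, rfl⟩ | ⟨p2', q2', h2, rfl, rfl⟩
      · omega
      · have := dl_ne p p2'
        omega
    · rcases hp2 with ⟨rfl, rfl⟩ | ⟨p2', q2', h2, rfl, rfl⟩
      · have := dl_ne p2 q'
        omega
      · rw [dl_lt_iff, dl_lt_iff, dl_lt_iff]
        exact hD.2 _ h _ h2

theorem att_card {m a : ℕ} {D : Finset (ℕ × ℕ)} (hD : NC m D) :
    (att a D).card = D.card + 1 := by
  rw [att, Finset.card_insert_of_notMem, Finset.card_image_of_injective]
  · rintro ⟨p, q⟩ ⟨p', q'⟩ h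
    simp only [Prod.mk.injEq] at h
    rw [dl_inj h.1, dl_inj h.2]
  · intro h
    simp only [Finset.mem_image, Prod.exists, Prod.mk.injEq] at h
    obtain ⟨p, q, h1, h2, h3⟩ := h
    have := hD.1 _ h1
    simp only [dl] at h2 h3 this
    split_ifs at h2 h3 <;> omega

theorem att_ear {m a : ℕ} (ha : a < m) (D : Finset (ℕ × ℕ)) : Ear m a (att a D) D := by
  refine ⟨ha, ?_⟩
  intro p q
  constructor
  · rintro ⟨e1, e2, e3⟩
    rw [att_mem] at e3
    by_cases hpa : p = a + 1
    · rcases e3 with e3 | e3 | ⟨⟨e3, e4⟩ | ⟨p', q', h, h1, h2⟩⟩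
      · right; left; omega
      · omega
      · omega
      · exact absurd (h1.symm.trans hpa) (dl_ne _ _)
    · by_cases hqa : q = a + 1
      · rcases e3 with e3 | e3 | ⟨⟨e3, e4⟩ | ⟨p', q', h, h1, h2⟩⟩
        · left; omega
        · omega
        · omega
        · exact absurd (h2.symm.trans hqa) (dl_ne _ _)
      · right; right
        refine ⟨sg a p, sg a q, ⟨?_, ?_, ?_⟩, (dl_sg hpa).symm, (dl_sg hqa).symm⟩
        · rw [← dl_lt_iff a, dl_sg hpa, dl_sg hqa]; exact e1
        · simp only [sg]; split_ifs <;> omega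
        · rcases e3 with e3 | e3 | ⟨⟨e3, e4⟩ | ⟨p', q', h, h1, h2⟩⟩
          · left; simp only [sg]; split_ifs <;> omega
          · right; left; simp only [sg]; split_ifs <;> omega
          · left; simp only [sg]; split_ifs <;> omega
          · right; right
            rw [h1, h2, sg_dl, sg_dl]; exact h
  · rintro (⟨rfl, rfl⟩ | ⟨rfl, rfl⟩ | ⟨p', q', ⟨e1, e2, e3⟩, rfl, rfl⟩)
    · exact ⟨by omega, by omega, Or.inl rfl⟩
    · exact ⟨by omega, by omega, Or.inl rfl⟩
    · refine ⟨(dl_lt_iff _ _ _).2 e1, ?_, ?_⟩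
      · simp only [dl]; split_ifs <;> omega
      · rw [att_mem]
        rcases e3 with e3 | e3 | e3
        · by_cases h9 : p' = a
          · right; right; left
            rw [e3, h9, dl_le le_rfl, dl_gt (by omega)]
            omega
          · left; simp only [dl]; split_ifs <;> omega
        · right; left; simp only [dl]; split_ifs <;> omega
        · exact Or.inr (Or.inr (Or.inr ⟨_, _, e3, rfl, rfl⟩))

/-- There is some triangulation. -/
theorem exists_nc (n : ℕ) (hn : 2 ≤ n) : ∃ D, NC n D ∧ D.card = n - 2 := by
  induction n, hn using Nat.le_induction with
  | base => exact ⟨∅, ⟨by simp, by simp⟩, by simp⟩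
  | succ n hn ih =>
    obtain ⟨D, h1, h2⟩ := ih
    refine ⟨att 0 D, att_nc hn (by omega) h1, ?_⟩
    rw [att_card h1]; omega

theorem seg_of_g2 (X : SSet) (H : G2 X) (n : ℕ) (hn : 2 ≤ n) : ∀ D, NC n D → D.card = n - 2 →
    InjT X n D ∧ SurjS X n D := by
  induction n, hn using Nat.le_induction with
  | base => exact fun D _ _ => ⟨base_inj X D, base_surj X D⟩
  | succ n hn ih =>
    intro D hD hc
    obtain ⟨a, D', h1, h2, he⟩ := exists_ear hn hD hc
    obtain ⟨i1, i2⟩ := ih D' h1 h2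
    have := H n a he.1
    exact ⟨he.inj X this.1 i1, he.surj X this.2 i2⟩

theorem g2_of_seg (X : SSet) (H : ∀ n, 3 ≤ n → ∀ D, NC n D → D.card = n - 2 →
    InjT X n D ∧ SurjT X n D) : G2 X := by
  intro m a ha
  rcases Nat.lt_or_ge m 2 with h | h
  · obtain ⟨rfl, rfl⟩ : m = 1 ∧ a = 0 := by omega
    have hid : ∀ v : XS X 2, R X 2 2 (fun j => 0 + j) v = v := by
      intro v
      apply R_id
      intro j _
      omega
    constructor
    · intro v v' _ h2
      rwa [hid, hid] at h2
    · intro w z hwz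
      refine ⟨z, ?_, hid z⟩
      rw [R_id X (f := ed 0 (0 + 1))] at hwz
      · rw [← hwz]
        apply R_congr
        intro j hj
        simp only [dl, ed]
        split_ifs <;> omega
      · intro j hj
        simp only [ed]
        split_ifs <;> omega
  · obtain ⟨D, h1, h2⟩ := exists_nc m h
    have hI : InjT X m D := by
      rcases Nat.lt_or_ge m 3 with h3 | h3
      · obtain rfl : m = 2 := by omega
        exact base_inj X D
      · exact (H m h3 D h1 h2).1
    have hE := att_ear ha D
    have := H (m + 1) (by omega) (att a D) (att_nc h ha h1) (by rw [att_card h1]; omega)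
    exact ⟨hE.gu X this.1, hE.ge X hI this.2⟩

/-- The right side of the theorem, for one triangulation. -/
def RHS (X : SSet) (n : ℕ) (𝒯 : Triangulation n) : Prop :=
      Function.Injective (fun (x : XS X n) =>
        fun (a b c : Fin (n + 1)) (h : 𝒯.IsTri a b c) =>
          sTri X a b c h.1.1.le h.2.1.1.le x) ∧
      ∀ (g : ∀ a b : Fin (n + 1), 𝒯.IsEdge a b → XS X 1)
        (f : ∀ a b c : Fin (n + 1), 𝒯.IsTri a b c → XS X 2),
        (∀ (a b c : Fin (n + 1)) (h : 𝒯.IsTri a b c),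
          sEdge X (0 : Fin 3) 1 (by decide) (f a b c h) = g a b h.1 ∧
          sEdge X (1 : Fin 3) 2 (by decide) (f a b c h) = g b c h.2.1 ∧
          sEdge X (0 : Fin 3) 2 (by decide) (f a b c h) = g a c h.2.2) →
        ∃ x : XS X n, ∀ (a b c : Fin (n + 1)) (h : 𝒯.IsTri a b c),
          sTri X a b c h.1.1.le h.2.1.1.le x = f a b c h

/-- The two descriptions of a triangulation agree. -/
def TriRel {n : ℕ} (𝒯 : Triangulation n) (D : Finset (ℕ × ℕ)) : Prop :=
  ∀ a b : Fin (n + 1), (a, b) ∈ 𝒯.diag ↔ (a.val, b.val) ∈ D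

theorem TriRel.edge {n : ℕ} {𝒯 : Triangulation n} {D : Finset (ℕ × ℕ)} (h : TriRel 𝒯 D)
    (a b : Fin (n + 1)) : 𝒯.IsEdge a b ↔ EE n D a.val b.val := by
  simp only [Triangulation.IsEdge, EE, h a b, Fin.lt_def]
  have := b.isLt
  constructor
  · rintro ⟨h1, h2⟩; exact ⟨h1, by omega, h2⟩
  · rintro ⟨h1, _, h2⟩; exact ⟨h1, h2⟩

theorem TriRel.tri {n : ℕ} {𝒯 : Triangulation n} {D : Finset (ℕ × ℕ)} (h : TriRel 𝒯 D)
    (a b c : Fin (n + 1)) : 𝒯.IsTri a b c ↔ TT n D a.val b.val c.val := by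
  simp only [Triangulation.IsTri, TT, h.edge]

theorem TriRel.to_rhs (X : SSet) {n : ℕ} (hn : 3 ≤ n) {𝒯 : Triangulation n} {D : Finset (ℕ × ℕ)}
    (h : TriRel 𝒯 D) (hI : InjT X n D) (hS : SurjT X n D) : RHS X n 𝒯 := by
  constructor
  · intro x x' hx
    apply hI
    intro a b c ht
    have hc := ht.2.1.2.1
    have hb := ht.2.1.1
    have ha := ht.1.1
    have := congrFun (congrFun (congrFun (congrFun hx ⟨a, by omega⟩) ⟨b, by omega⟩) ⟨c, by omega⟩)
      ((h.tri _ _ _).2 ht)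
    dsimp only at this
    rwa [sTri_eq, sTri_eq] at this
  · intro g f hgf
    classical
    have x1 : XS X 1 := g ⟨0, by omega⟩ ⟨1, by omega⟩ ((h.edge _ _).2 ⟨by simp, by simp; omega, Or.inl rfl⟩)
    have x2 : XS X 2 := R X 2 1 (fun _ => 0) x1
    obtain ⟨x, hx⟩ := hS
      (fun a b => if h' : ∃ (ha : a < n + 1) (hb : b < n + 1), 𝒯.IsEdge ⟨a, ha⟩ ⟨b, hb⟩ then
        g ⟨a, h'.1⟩ ⟨b, h'.2.1⟩ h'.2.2 else x1)
      (fun a b c => if h' : ∃ (ha : a < n + 1) (hb : b < n + 1) (hc : c < n + 1),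
        𝒯.IsTri ⟨a, ha⟩ ⟨b, hb⟩ ⟨c, hc⟩ then
        f ⟨a, h'.1⟩ ⟨b, h'.2.1⟩ ⟨c, h'.2.2.1⟩ h'.2.2.2 else x2) (by
        intro a b c ht
        have hc := ht.2.1.2.1
        have hb := ht.2.1.1
        have ha := ht.1.1
        have hT : 𝒯.IsTri ⟨a, by omega⟩ ⟨b, by omega⟩ ⟨c, by omega⟩ := (h.tri _ _ _).2 ht
        dsimp only
        rw [dif_pos ⟨by omega, by omega, by omega, hT⟩, dif_pos ⟨by omega, by omega, hT.1⟩,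
          dif_pos ⟨by omega, by omega, hT.2.1⟩, dif_pos ⟨by omega, by omega, hT.2.2⟩]
        have := hgf _ _ _ hT
        rw [sEdge_eq, sEdge_eq, sEdge_eq] at this
        exact this)
    refine ⟨x, ?_⟩
    intro a b c hT
    rw [sTri_eq, hx _ _ _ ((h.tri _ _ _).1 hT)]
    exact dif_pos ⟨a.isLt, b.isLt, c.isLt, hT⟩

theorem TriRel.of_rhs (X : SSet) {n : ℕ} {𝒯 : Triangulation n} {D : Finset (ℕ × ℕ)}
    (h : TriRel 𝒯 D) (hR : RHS X n 𝒯) : InjT X n D ∧ SurjT X n D := by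
  constructor
  · intro x x' hx
    apply hR.1
    funext a b c hT
    dsimp only
    rw [sTri_eq, sTri_eq]
    exact hx _ _ _ ((h.tri _ _ _).1 hT)
  · intro g f hgf
    obtain ⟨x, hx⟩ := hR.2 (fun a b _ => g a.val b.val) (fun a b c _ => f a.val b.val c.val) (by
      intro a b c hT
      rw [sEdge_eq, sEdge_eq, sEdge_eq]
      exact hgf _ _ _ ((h.tri _ _ _).1 hT))
    refine ⟨x, ?_⟩
    intro a b c ht
    have hc := ht.2.1.2.1
    have hb := ht.2.1.1
    have ha := ht.1.1
    have := hx ⟨a, by omega⟩ ⟨b, by omega⟩ ⟨c, by omega⟩ ((h.tri _ _ _).2 ht)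
    rwa [sTri_eq] at this

theorem val_pair_inj (n : ℕ) :
    Function.Injective (fun p : Fin (n + 1) × Fin (n + 1) => (p.1.val, p.2.val)) := by
  rintro ⟨p, q⟩ ⟨p', q'⟩ h
  simp only [Prod.mk.injEq] at h
  rw [Fin.ext h.1, Fin.ext h.2]

theorem exists_rel {n : ℕ} (𝒯 : Triangulation n) : ∃ D, NC n D ∧ D.card = n - 2 ∧ TriRel 𝒯 D := by
  refine ⟨𝒯.diag.image (fun p => (p.1.val, p.2.val)), ⟨?_, ?_⟩, ?_, ?_⟩
  · intro p hp
    obtain ⟨q, hq, rfl⟩ := Finset.mem_image.1 hp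
    have := 𝒯.mem_diag q hq
    have := q.2.isLt
    dsimp only
    omega
  · intro p hp p' hp'
    obtain ⟨q, hq, rfl⟩ := Finset.mem_image.1 hp
    obtain ⟨q', hq', rfl⟩ := Finset.mem_image.1 hp'
    exact 𝒯.noncross q hq q' hq'
  · rw [Finset.card_image_of_injective _ (val_pair_inj n), 𝒯.card_eq]
  · intro a b
    exact ((val_pair_inj n).mem_finset_image (s := 𝒯.diag) (a := (a, b))).symm

theorem exists_rel' {n : ℕ} {D : Finset (ℕ × ℕ)} (hD : NC n D) (hc : D.card = n - 2) :
    ∃ 𝒯 : Triangulation n, TriRel 𝒯 D := by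
  refine ⟨⟨Finset.univ.filter (fun p => (p.1.val, p.2.val) ∈ D), ?_, ?_, ?_⟩, ?_⟩
  · intro p hp
    have := hD.1 _ (Finset.mem_filter.1 hp).2
    exact ⟨this.1, this.2.2⟩
  · intro p hp q hq
    exact hD.2 _ (Finset.mem_filter.1 hp).2 _ (Finset.mem_filter.1 hq).2
  · rw [← hc, ← Finset.card_image_of_injective _ (val_pair_inj n)]
    congr 1
    ext ⟨p, q⟩
    simp only [Finset.mem_image, Finset.mem_filter, Finset.mem_univ, true_and]
    constructor
    · rintro ⟨x, hx, he⟩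
      rw [← he]; exact hx
    · intro h
      have := hD.1 _ h
      dsimp only at this
      exact ⟨(⟨p, by omega⟩, ⟨q, by omega⟩), h, rfl⟩
  · intro a b
    simp

theorem rhs_iff_g2 (X : SSet) : G2 X ↔ ∀ n : ℕ, 3 ≤ n → ∀ 𝒯 : Triangulation n, RHS X n 𝒯 := by
  constructor
  · intro H n hn 𝒯
    obtain ⟨D, h1, h2, h3⟩ := exists_rel 𝒯
    obtain ⟨hI, hS⟩ := seg_of_g2 X H n (by omega) D h1 h2
    refine h3.to_rhs X hn hI ?_
    intro g f hgf
    obtain ⟨x, hx, _⟩ := hS g f hgf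
    exact ⟨x, hx⟩
  · intro H
    apply g2_of_seg
    intro n hn D h1 h2
    obtain ⟨𝒯, h3⟩ := exists_rel' h1 h2
    exact h3.of_rhs X (H n hn 𝒯)

/-- For a simplicial set `X`, the collection `Q_X` with
colours `X₁`, whose `n`-ary operations with inputs `c₁, …, cₙ` and output `c₀`
are the `n`-simplices with consecutive edges `cᵢ` and long edge `c₀`, with the
cocomposition maps induced by the operad of standard simplices, is an
invertible cooperad — i.e. all counit maps and all cocomposition maps
(restricted to colour components) are bijections — if and only if `X` is a
2-Segal set, i.e. for every `n ≥ 3` and every triangulation `𝒯` of the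
`(n+1)`-gon the induced map `X_n → Hom(Δ[𝒯], X)` is a bijection. -/
theorem cooperad_invertible_iff_twoSegal (X : SSet) :
    ((∀ c0 : XS X 1,
        Function.Bijective (fun _ : QX X 1 (fun _ => c0) c0 => PUnit.unit)) ∧
     (∀ (n : ℕ) (k : Fin n → ℕ) (c0 : XS X 1)
        (d : ∀ i : Fin n, Fin (k i) → XS X 1) (c' : Fin (∑ t, k t) → XS X 1),
        (∀ (i : Fin n) (r : Fin (k i)),
          c' ⟨psum k i.val + r.val,
            by have := psum_add_le k i (r.val + 1) r.isLt; omega⟩ = d i r) →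
        Function.Injective (fun x : QX X (∑ t, k t) c' c0 =>
            (X.map (outerHom k).op x.1, fun i => X.map (innerHom k i).op x.1)) ∧
        (∀ (y : XS X n) (z : ∀ i, XS X (k i)),
          sEdge X 0 (Fin.last n) (Fin.zero_le _) y = c0 →
          (∀ (i : Fin n) (r : Fin (k i)),
            sEdge X r.castSucc r.succ (Fin.castSucc_le_succ r) (z i) = d i r) →
          (∀ i : Fin n, sEdge X 0 (Fin.last (k i)) (Fin.zero_le _) (z i) =
            sEdge X i.castSucc i.succ (Fin.castSucc_le_succ i) y) →
          ∃ x : QX X (∑ t, k t) c' c0,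
            X.map (outerHom k).op x.1 = y ∧
              ∀ i, X.map (innerHom k i).op x.1 = z i))) ↔
    (∀ n : ℕ, 3 ≤ n → ∀ 𝒯 : Triangulation n,
      Function.Injective (fun (x : XS X n) =>
        fun (a b c : Fin (n + 1)) (h : 𝒯.IsTri a b c) =>
          sTri X a b c h.1.1.le h.2.1.1.le x) ∧
      ∀ (g : ∀ a b : Fin (n + 1), 𝒯.IsEdge a b → XS X 1)
        (f : ∀ a b c : Fin (n + 1), 𝒯.IsTri a b c → XS X 2),
        (∀ (a b c : Fin (n + 1)) (h : 𝒯.IsTri a b c),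
          sEdge X (0 : Fin 3) 1 (by decide) (f a b c h) = g a b h.1 ∧
          sEdge X (1 : Fin 3) 2 (by decide) (f a b c h) = g b c h.2.1 ∧
          sEdge X (0 : Fin 3) 2 (by decide) (f a b c h) = g a c h.2.2) →
        ∃ x : XS X n, ∀ (a b c : Fin (n + 1)) (h : 𝒯.IsTri a b c),
          sTri X a b c h.1.1.le h.2.1.1.le x = f a b c h) := by
  exact (lhs_iff_g2 X).trans (rhs_iff_g2 X)
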